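/- Let k be a field of characteristic 0, k' a finite extension of k, and K = k'((s)). The map Ω is multiplicative in each of the three slots and alternating: (i) if (ỹᵢ, ŷᵢ) and (ỹᵢ′, ŷᵢ′) for i = 1, 2, 3 are pairs of units of K[t]/(t³) with ỹᵢ ≡ ŷᵢ and ỹᵢ′ ≡ ŷᵢ′ mod t², then Ω((ỹ₁ỹ₁′, ỹ₂, ỹ₃), (ŷ₁ŷ₁′, ŷ₂, ŷ₃)) = Ω((ỹ₁, ỹ₂, ỹ₃), (ŷ₁, ŷ₂, ŷ₃)) + Ω((ỹ₁′, ỹ₂, ỹ₃), (ŷ₁′, ŷ₂, ŷ₃)), and similarly in the second and third slots; (ii) for every permutation σ ∈ S₃, Ω((ỹ_{σ(1)}, ỹ_{σ(2)}, ỹ_{σ(3)}), (ŷ_{σ(1)}, ŷ_{σ(2)}, ŷ_{σ(3)})) = sgn(σ)·Ω((ỹ₁, ỹ₂, ỹ₃), (ŷ₁, ŷ₂, ŷ₃)). Consequently Ω induces a map on the exterior cube of the group of congruent pairs of units. -/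

import Mathlib

noncomputable section

/-- The formal derivative `d/ds` on the field of Laurent series `k'((s))`. -/
def lsDeriv {k' : Type*} [Field k'] (f : LaurentSeries k') : LaurentSeries k' where
  coeff n := (n + 1 : ℤ) • f.coeff (n + 1)
  isPWO_support' := by
    refine Set.IsPWO.mono (Set.IsPWO.image_of_monotoneOn (f.isPWO_support)
      (fun x _ y _ h => by simpa using h : MonotoneOn (fun m : ℤ => m - 1) f.support)) ?_
    intro n hn
    refine ⟨n + 1, ?_, by ring⟩
    simp only [Function.mem_support, ne_eq] at hn ⊢
    intro h
    exact hn (by simp [HahnSeries.support, h] at hn ⊢)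

/-- The truncated polynomial ring `K[t]/(t³)`. -/
abbrev T3 (K : Type*) [Field K] := Polynomial K ⧸ Ideal.span {(Polynomial.X : Polynomial K) ^ 3}

/-- The class of `t` in `K[t]/(t³)`. -/
def tE (K : Type*) [Field K] : T3 K := Ideal.Quotient.mk _ Polynomial.X

/-- The constant `x` viewed in `K[t]/(t³)`. -/
def cE {K : Type*} [Field K] (x : K) : T3 K := algebraMap K (T3 K) x

/-- The truncated exponential `exp(u) = 1 + u + u²/2` on `K[t]/(t³)`, well defined in
characteristic zero for `u` in the ideal `(t)`. -/
def expE {K : Type*} [Field K] (u : T3 K) : T3 K := 1 + u + cE (2⁻¹ : K) * u ^ 2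

/-- The element `α₀ · exp(α₁ t + α₂ t²)` of `K[t]/(t³)`; every unit of `K[t]/(t³)` has a
unique such exponential decomposition with `α₀ ∈ K^×`, `α₁, α₂ ∈ K`. -/
def unitE {K : Type*} [Field K] (α₀ α₁ α₂ : K) : T3 K :=
  cE α₀ * expE (cE α₁ * tE K + cE α₂ * tE K ^ 2)

/-- The canonical expression `Ω(p̃, p̂) ∈ K` of the paper (the canonical 1-form is
`Ω(p̃,p̂)·ds`), evaluated via the exponential parameters `(a0 i, a1 i, x2 i)` of the entries
of `p̃` and `(a0 i, a1 i, y2 i)` of the entries of `p̂` (congruent mod `t²`, so the parameters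
`a0`, `a1` are shared); `D` is the derivative of `K`:
`Ω(p̃, p̂) = Σ_{σ∈S₃} sgn(σ)·a1(σ1)·(x2(σ3) − y2(σ3))·(D(a0(σ2))/a0(σ2))`. -/
def Omega {K : Type*} [Field K] (D : K → K) (a0 a1 x2 y2 : Fin 3 → K) : K :=
  ∑ σ : Equiv.Perm (Fin 3),
    (Equiv.Perm.sign σ : ℤ) •
      (a1 (σ 0) * ((x2 (σ 2) - y2 (σ 2)) * (D (a0 (σ 1)) / a0 (σ 1))))

/-- The Euler operator `s·d/ds` on Laurent series. -/
def lsEuler {F : Type*} [Field F] (f : LaurentSeries F) : LaurentSeries F where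
  coeff n := (n : F) * f.coeff n
  isPWO_support' := f.isPWO_support.mono fun n hn h => hn (by simp [h])

theorem lsEuler_coeff {F : Type*} [Field F] (f : LaurentSeries F) (n : ℤ) :
    (lsEuler f).coeff n = (n : F) * f.coeff n := rfl

theorem support_lsEuler_subset {F : Type*} [Field F] (f : LaurentSeries F) :
    (lsEuler f).support ⊆ f.support :=
  fun n hn h => hn (by simp [lsEuler_coeff, h])

theorem lsEuler_mul {F : Type*} [Field F] (f g : LaurentSeries F) :
    lsEuler (f * g) = lsEuler f * g + f * lsEuler g := by
  ext n
  rw [HahnSeries.coeff_add, HahnSeries.coeff_mul_left' f.isPWO_support (support_lsEuler_subset f),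
    HahnSeries.coeff_mul_right' g.isPWO_support (support_lsEuler_subset g), lsEuler_coeff,
    HahnSeries.coeff_mul, Finset.mul_sum, ← Finset.sum_add_distrib]
  refine Finset.sum_congr rfl fun ij hij => ?_
  obtain ⟨-, -, rfl⟩ := Finset.mem_antidiagonal.mp hij
  simp only [lsEuler_coeff]
  push_cast
  ring

theorem lsDeriv_eq_single_mul_lsEuler {F : Type*} [Field F] (f : LaurentSeries F) :
    lsDeriv f = HahnSeries.single (-1) 1 * lsEuler f := by
  ext n
  rw [HahnSeries.coeff_single_mul, lsEuler_coeff]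
  simp [lsDeriv]

theorem lsDeriv_mul {F : Type*} [Field F] (f g : LaurentSeries F) :
    lsDeriv (f * g) = lsDeriv f * g + f * lsDeriv g := by
  simp only [lsDeriv_eq_single_mul_lsEuler, lsEuler_mul]
  ring

theorem logDeriv_lsDeriv_mul {F : Type*} [Field F] {f g : LaurentSeries F} (hf : f ≠ 0)
    (hg : g ≠ 0) : lsDeriv (f * g) / (f * g) = lsDeriv f / f + lsDeriv g / g := by
  rw [lsDeriv_mul]
  field_simp

theorem tE_pow_three (K : Type*) [Field K] : tE K ^ 3 = 0 := by
  rw [tE, ← map_pow]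
  exact Ideal.Quotient.eq_zero_iff_mem.mpr (Ideal.mem_span_singleton_self _)

theorem unitE_eq {K : Type*} [Field K] (a b c : K) :
    unitE a b c = cE a + cE (a * b) * tE K + cE (a * (c + 2⁻¹ * b ^ 2)) * tE K ^ 2 := by
  have h := tE_pow_three K
  simp only [unitE, expE, cE, map_mul, map_add, map_pow]
  linear_combination (algebraMap K (T3 K) a * algebraMap K (T3 K) 2⁻¹ *
    (2 * algebraMap K (T3 K) b * algebraMap K (T3 K) c +
      algebraMap K (T3 K) c ^ 2 * tE K)) * h

theorem quadratic_tE_inj {K : Type*} [Field K] {a b c a' b' c' : K}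
    (h : cE a + cE b * tE K + cE c * tE K ^ 2 = cE a' + cE b' * tE K + cE c' * tE K ^ 2) :
    a = a' ∧ b = b' ∧ c = c' := by
  have key : ∀ x y z : K, cE x + cE y * tE K + cE z * tE K ^ 2 =
      Ideal.Quotient.mk _ (Polynomial.C x + Polynomial.C y * Polynomial.X +
        Polynomial.C z * Polynomial.X ^ 2) := fun _ _ _ => rfl
  rw [key, key, Ideal.Quotient.eq, Ideal.mem_span_singleton, Polynomial.X_pow_dvd_iff] at h
  have e0 := h 0 (by norm_num)
  have e1 := h 1 (by norm_num)
  have e2 := h 2 (by norm_num)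
  simp [Polynomial.coeff_X, Polynomial.coeff_C, Polynomial.coeff_X_pow] at e0 e1 e2
  exact ⟨sub_eq_zero.mp e0, sub_eq_zero.mp e1, sub_eq_zero.mp e2⟩

theorem unitE_inj {K : Type*} [Field K] {a b c a' b' c' : K} (ha : a ≠ 0)
    (h : unitE a b c = unitE a' b' c') : a = a' ∧ b = b' ∧ c = c' := by
  rw [unitE_eq, unitE_eq] at h
  obtain ⟨rfl, h1, h2⟩ := quadratic_tE_inj h
  obtain rfl := mul_left_cancel₀ ha h1
  exact ⟨rfl, rfl, add_right_cancel (mul_left_cancel₀ ha h2)⟩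

theorem unitE_mul {K : Type*} [Field K] (hK : (2 : K) ≠ 0) (a b c a' b' c' : K) :
    unitE a b c * unitE a' b' c' = unitE (a * a') (b + b') (c + c') := by
  have h := tE_pow_three K
  have h2 : cE (2⁻¹ : K) * 2 = 1 := by
    rw [cE, ← map_ofNat (algebraMap K (T3 K)) 2, ← map_mul, inv_mul_cancel₀ hK, map_one]
  simp only [unitE_eq]
  simp only [cE, map_mul, map_add, map_pow] at h2 ⊢
  generalize algebraMap K (T3 K) a = A, algebraMap K (T3 K) b = B, algebraMap K (T3 K) c = C,
    algebraMap K (T3 K) a' = A', algebraMap K (T3 K) b' = B', algebraMap K (T3 K) c' = C',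
    algebraMap K (T3 K) 2⁻¹ = q, tE K = t at *
  linear_combination (A * A' * (B * (C' + q * B' ^ 2) + B' * (C + q * B ^ 2) +
    (C + q * B ^ 2) * (C' + q * B' ^ 2) * t)) * h - A * A' * B * B' * t ^ 2 * h2

theorem Omega_eq_det {K : Type*} [Field K] (D : K → K) (a0 a1 x2 y2 : Fin 3 → K) :
    Omega D a0 a1 x2 y2 =
      (Matrix.of fun i => ![a1 i, D (a0 i) / a0 i, x2 i - y2 i]).det := by
  rw [Matrix.det_apply, Omega]
  refine Finset.sum_congr rfl fun σ _ => ?_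
  rw [Fin.prod_univ_three, Units.smul_def]
  congr 1
  simp only [Matrix.of_apply, Matrix.cons_val]
  ring

theorem Omega_comp_perm {K : Type*} [Field K] (D : K → K) (a0 a1 x2 y2 : Fin 3 → K)
    (σ : Equiv.Perm (Fin 3)) :
    Omega D (a0 ∘ σ) (a1 ∘ σ) (x2 ∘ σ) (y2 ∘ σ) =
      (Equiv.Perm.sign σ : ℤ) • Omega D a0 a1 x2 y2 := by
  rw [Omega_eq_det, Omega_eq_det, zsmul_eq_mul, ← Matrix.det_permute]
  rfl

theorem Omega_update_add {K : Type*} [Field K] (D : K → K)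
    (a0 a1 x2 y2 c0 c1 xc yc : Fin 3 → K) (j : Fin 3) (b0 b1 xb yb : K)
    (hne : ∀ i, i ≠ j → c0 i = a0 i ∧ c1 i = a1 i ∧ xc i = x2 i ∧ yc i = y2 i)
    (h0 : D (c0 j) / c0 j = D (a0 j) / a0 j + D b0 / b0) (h1 : c1 j = a1 j + b1)
    (hx : xc j = x2 j + xb) (hy : yc j = y2 j + yb) :
    Omega D c0 c1 xc yc = Omega D a0 a1 x2 y2 +
      Omega D (Function.update a0 j b0) (Function.update a1 j b1)
        (Function.update x2 j xb) (Function.update y2 j yb) := by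
  simp only [Omega_eq_det]
  set M : Matrix (Fin 3) (Fin 3) K :=
    Matrix.of fun i => ![a1 i, D (a0 i) / a0 i, x2 i - y2 i] with hM
  have hb : (Matrix.of fun i => ![Function.update a1 j b1 i,
      D (Function.update a0 j b0 i) / Function.update a0 j b0 i,
      Function.update x2 j xb i - Function.update y2 j yb i]) =
      M.updateRow j ![b1, D b0 / b0, xb - yb] := by
    ext i l
    by_cases h : i = j
    · subst h; simp
    · simp [h, hM]
  have hc : (Matrix.of fun i => ![c1 i, D (c0 i) / c0 i, xc i - yc i]) =
      M.updateRow j (M j + ![b1, D b0 / b0, xb - yb]) := by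
    ext i l
    by_cases h : i = j
    · subst h
      rw [Matrix.updateRow_self]
      fin_cases l
      · simp [hM, h1]
      · simp [hM, h0]
      · simp [hM, hx, hy]
        ring
    · obtain ⟨e0, e1, ex, ey⟩ := hne i h
      simp [h, hM, e0, e1, ex, ey]
  rw [hb, hc, Matrix.det_updateRow_add, Matrix.updateRow_eq_self]

/-- Let `k` be a field of characteristic `0`, `k'` a finite extension of `k`,
and `K = k'((s))`.  Let `p̃ = (ỹ₁,ỹ₂,ỹ₃)` and `p̂ = (ŷ₁,ŷ₂,ŷ₃)` be triples of units of
`K[t]/(t³)` with `ỹᵢ ≡ ŷᵢ mod t²` — encoded by shared exponential parameters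
`a0 i ∈ K^×`, `a1 i` and second-order parameters `x2 i`, `y2 i`.  The map `Ω` is
multiplicative in each of the three slots and alternating:
(i) for every slot `j` and every additional pair `(ỹ′, ŷ′)` of units with `ỹ′ ≡ ŷ′ mod t²`
(with exponential parameters `b0 ∈ K^×, b1, xb2, yb2`), if the triples obtained by
multiplying the `j`-th entries by `ỹ′` resp. `ŷ′` have exponential parameters
`c0 i ∈ K^×, c1 i, xc2 i, yc2 i`, then `Ω` of the product pair equals `Ω(p̃, p̂)` plus `Ω`
of the pair of triples whose `j`-th entries are replaced by `ỹ′` resp. `ŷ′`;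
(ii) for every permutation `σ ∈ S₃`, `Ω(σ·p̃, σ·p̂) = sgn(σ)·Ω(p̃, p̂)`.
Consequently `Ω` induces a map on the exterior cube of the group of congruent pairs of
units. -/
theorem statement_5 {k : Type*} [Field k] [CharZero k] {k' : Type*} [Field k']
    [Algebra k k'] [FiniteDimensional k k']
    (ty hy : Fin 3 → T3 (LaurentSeries k'))
    (a0 a1 x2 y2 : Fin 3 → LaurentSeries k') (h0 : ∀ i, a0 i ≠ 0)
    (hty : ∀ i, ty i = unitE (a0 i) (a1 i) (x2 i))
    (hhy : ∀ i, hy i = unitE (a0 i) (a1 i) (y2 i)) :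
    (∀ (j : Fin 3) (ty' hy' : T3 (LaurentSeries k')) (b0 b1 xb2 yb2 : LaurentSeries k'),
      b0 ≠ 0 → ty' = unitE b0 b1 xb2 → hy' = unitE b0 b1 yb2 →
      ∀ (c0 c1 xc2 yc2 : Fin 3 → LaurentSeries k'), (∀ i, c0 i ≠ 0) →
        (∀ i, Function.update ty j (ty j * ty') i = unitE (c0 i) (c1 i) (xc2 i)) →
        (∀ i, Function.update hy j (hy j * hy') i = unitE (c0 i) (c1 i) (yc2 i)) →
        Omega lsDeriv c0 c1 xc2 yc2
          = Omega lsDeriv a0 a1 x2 y2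
            + Omega lsDeriv (Function.update a0 j b0) (Function.update a1 j b1)
                (Function.update x2 j xb2) (Function.update y2 j yb2))
    ∧ (∀ σ : Equiv.Perm (Fin 3),
        Omega lsDeriv (a0 ∘ σ) (a1 ∘ σ) (x2 ∘ σ) (y2 ∘ σ)
          = (Equiv.Perm.sign σ : ℤ) • Omega lsDeriv a0 a1 x2 y2) := by
  have : CharZero k' := charZero_of_injective_algebraMap (algebraMap k k').injective
  have h2 : (2 : LaurentSeries k') ≠ 0 := by
    have : CharZero (LaurentSeries k') :=
      charZero_of_injective_algebraMap (algebraMap k' (LaurentSeries k')).injective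
    exact two_ne_zero
  refine ⟨?_, fun σ => Omega_comp_perm _ _ _ _ _ σ⟩
  rintro j _ _ b0 b1 xb2 yb2 hb0 rfl rfl c0 c1 xc2 yc2 hc0 ht hh
  have htj := ht j
  have hhj := hh j
  rw [Function.update_self, hty, unitE_mul h2] at htj
  rw [Function.update_self, hhy, unitE_mul h2] at hhj
  obtain ⟨e0, e1, ex⟩ := unitE_inj (mul_ne_zero (h0 j) hb0) htj
  obtain ⟨-, -, ey⟩ := unitE_inj (mul_ne_zero (h0 j) hb0) hhj
  refine Omega_update_add _ _ _ _ _ _ _ _ _ j _ _ _ _ (fun i hi => ?_) ?_ e1.symm ex.symm ey.symm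
  · have hti := ht i
    have hhi := hh i
    rw [Function.update_of_ne hi, hty] at hti
    rw [Function.update_of_ne hi, hhy] at hhi
    obtain ⟨f0, f1, fx⟩ := unitE_inj (h0 i) hti
    obtain ⟨-, -, fy⟩ := unitE_inj (h0 i) hhi
    exact ⟨f0.symm, f1.symm, fx.symm, fy.symm⟩
  · rw [← e0, logDeriv_lsDeriv_mul (h0 j) hb0]

end
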